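/- arXiv:1512.01994 — 2 statements merged into one kernel-verified Lean document; each statement's English description precedes it below -/
import Mathlib

section
/- Let G be a finite simple graph, let S be a maximum critical independent set of G, and let X = N[S]. Then diadem(G) ⊆ diadem(G[X]) and nucleus(G[X]) ⊆ nucleus(G). -/
/-- `S` is an independent set in `G`: no two of its vertices are adjacent. -/
def IndepSet {V : Type*} (G : SimpleGraph V) (S : Set V) : Prop :=
  ∀ ⦃u⦄, u ∈ S → ∀ ⦃v⦄, v ∈ S → ¬G.Adj u v

/-- The independence number `α(G)`. -/
noncomputable def indNum {V : Type*} (G : SimpleGraph V) : ℕ :=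
  sSup {n : ℕ | ∃ S : Set V, IndepSet G S ∧ S.ncard = n}

/-- `Ω(G)`: the family of maximum independent sets of `G`. -/
def maxIndepFam {V : Type*} (G : SimpleGraph V) : Set (Set V) :=
  {S | IndepSet G S ∧ S.ncard = indNum G}

/-- `N(X)`: the neighborhood of a set of vertices. -/
def nbhd {V : Type*} (G : SimpleGraph V) (X : Set V) : Set V :=
  {v | ∃ x ∈ X, G.Adj v x}

/-- `N[X] = N(X) ∪ X`: the closed neighborhood of a set of vertices. -/
def closedNbhd {V : Type*} (G : SimpleGraph V) (X : Set V) : Set V :=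
  nbhd G X ∪ X

/-- The difference `d(X) = |X| - |N(X)|`. -/
noncomputable def diffd {V : Type*} (G : SimpleGraph V) (X : Set V) : ℤ :=
  (X.ncard : ℤ) - ((nbhd G X).ncard : ℤ)

/-- The critical difference `d(G) = max {d(X) : X ⊆ V(G)}`. -/
noncomputable def critDiff {V : Type*} (G : SimpleGraph V) : ℤ :=
  sSup {d : ℤ | ∃ X : Set V, diffd G X = d}

/-- `X` is a critical set if `d(X) = d(G)`. -/
def IsCritical {V : Type*} (G : SimpleGraph V) (X : Set V) : Prop :=
  diffd G X = critDiff G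

/-- `MaxCritIndep(G)`: the family of critical independent sets of maximum cardinality. -/
def maxCritIndepFam {V : Type*} (G : SimpleGraph V) : Set (Set V) :=
  {S | IndepSet G S ∧ IsCritical G S ∧
    ∀ T : Set V, IndepSet G T → IsCritical G T → T.ncard ≤ S.ncard}

/-- The critical independence number `α'(G)`. -/
noncomputable def critIndNum {V : Type*} (G : SimpleGraph V) : ℕ :=
  sSup {n : ℕ | ∃ S : Set V, IndepSet G S ∧ IsCritical G S ∧ S.ncard = n}

/-- `ker(G)`: the intersection of all critical independent sets. -/
def kerSet {V : Type*} (G : SimpleGraph V) : Set V :=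
  ⋂₀ {A : Set V | IndepSet G A ∧ IsCritical G A}

/-- `nucleus(G)`: the intersection of all maximum critical independent sets. -/
def nucleus {V : Type*} (G : SimpleGraph V) : Set V :=
  ⋂₀ maxCritIndepFam G

/-- `diadem(G)`: the union of all maximum critical independent sets. -/
def diadem {V : Type*} (G : SimpleGraph V) : Set V :=
  ⋃₀ maxCritIndepFam G

/-- `core(G)`: the intersection of all maximum independent sets. -/
def coreSet {V : Type*} (G : SimpleGraph V) : Set V :=
  ⋂₀ maxIndepFam G

/-- `corona(G)`: the union of all maximum independent sets. -/
def coronaSet {V : Type*} (G : SimpleGraph V) : Set V :=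
  ⋃₀ maxIndepFam G

/-- A matching in `G`: a set of pairwise non-incident edges of `G`. -/
def IsMatchingSet {V : Type*} (G : SimpleGraph V) (M : Set (Sym2 V)) : Prop :=
  M ⊆ G.edgeSet ∧ M.Pairwise fun e f => ∀ v, v ∈ e → v ∉ f

/-- The matching number `μ(G)`. -/
noncomputable def matchNum {V : Type*} (G : SimpleGraph V) : ℕ :=
  sSup {n : ℕ | ∃ M : Set (Sym2 V), IsMatchingSet G M ∧ M.ncard = n}

/-- `G` is a König-Egerváry graph if `α(G) + μ(G) = |V(G)|`. -/
def IsKonigEgervary {V : Type*} (G : SimpleGraph V) : Prop :=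
  indNum G + matchNum G = Nat.card V

/-- `Γ` is a König-Egerváry collection: a family of independent sets with
`|⋂Γ| + |⋃Γ| = 2α(G)`. -/
def IsKECollection {V : Type*} (G : SimpleGraph V) (Γ : Set (Set V)) : Prop :=
  (∀ S ∈ Γ, IndepSet G S) ∧ (⋂₀ Γ).ncard + (⋃₀ Γ).ncard = 2 * indNum G

theorem isCritical_iff_forall_diffd_le {V : Type*} [Finite V] (G : SimpleGraph V) (S : Set V) :
    IsCritical G S ↔ ∀ Z : Set V, diffd G Z ≤ diffd G S := by
  have hb : BddAbove {d : ℤ | ∃ X : Set V, diffd G X = d} :=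
    (Set.finite_range (diffd G)).bddAbove
  constructor
  · intro h Z
    rw [h]
    exact le_csSup hb ⟨Z, rfl⟩
  · intro h
    apply le_antisymm
    · exact le_csSup hb ⟨S, rfl⟩
    · refine csSup_le ⟨diffd G S, S, rfl⟩ ?_
      rintro _ ⟨Z, rfl⟩
      exact h Z

/-- Hall's condition for the neighborhood of a critical set. -/
theorem IsCritical.ncard_le_ncard_nbhd_inter {V : Type*} [Finite V] {G : SimpleGraph V}
    {S : Set V} (hS : IsCritical G S) {Y : Set V} (hY : Y ⊆ nbhd G S) :
    Y.ncard ≤ (nbhd G Y ∩ S).ncard := by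
  have h := (isCritical_iff_forall_diffd_le G S).1 hS (S \ nbhd G Y)
  have hsub : nbhd G (S \ nbhd G Y) ⊆ nbhd G S \ Y := by
    rintro v ⟨x, ⟨hxS, hxY⟩, hvx⟩
    exact ⟨⟨x, hxS, hvx⟩, fun hv => hxY ⟨v, hv, hvx.symm⟩⟩
  have h1 := Set.ncard_le_ncard hsub (Set.toFinite _)
  have h2 := Set.ncard_sdiff_add_ncard_of_subset hY (Set.toFinite _)
  have h3 := Set.ncard_inter_add_ncard_sdiff_eq_ncard S (nbhd G Y) (Set.toFinite _)
  rw [Set.inter_comm] at h3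
  unfold diffd at h
  omega

theorem IndepSet.disjoint_nbhd {V : Type*} {G : SimpleGraph V} {S : Set V}
    (hI : IndepSet G S) : Disjoint (nbhd G S) S :=
  Set.disjoint_left.2 fun _ ⟨_, hx, hvx⟩ hv => hI hv hx hvx

theorem IndepSet.ncard_inter_closedNbhd {V : Type*} [Finite V] {G : SimpleGraph V} {S : Set V}
    (hI : IndepSet G S) (Z : Set V) :
    (Z ∩ closedNbhd G S).ncard = (Z ∩ nbhd G S).ncard + (Z ∩ S).ncard := by
  rw [closedNbhd, Set.inter_union_distrib_left]
  exact Set.ncard_union_eq (hI.disjoint_nbhd.mono Set.inter_subset_right Set.inter_subset_right)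
    (Set.toFinite _) (Set.toFinite _)

/-- Inside the closed neighborhood of a critical independent set `S`, no set has larger
difference than `S`. -/
theorem IsCritical.ncard_inter_closedNbhd_sub_le {V : Type*} [Finite V] {G : SimpleGraph V}
    {S : Set V} (hS : IsCritical G S) (hI : IndepSet G S) (Z : Set V) :
    ((Z ∩ closedNbhd G S).ncard : ℤ) - ((nbhd G (Z ∩ closedNbhd G S) ∩ closedNbhd G S).ncard : ℤ)
      ≤ diffd G S := by
  have h := (isCritical_iff_forall_diffd_le G S).1 hS (Z ∩ S)
  have hall := hS.ncard_le_ncard_nbhd_inter (Y := Z ∩ nbhd G S) Set.inter_subset_right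
  have h1 := hI.ncard_inter_closedNbhd Z
  have h2 := hI.ncard_inter_closedNbhd (nbhd G (Z ∩ closedNbhd G S))
  have h3 : nbhd G (Z ∩ S) ⊆ nbhd G (Z ∩ closedNbhd G S) ∩ nbhd G S := by
    rintro v ⟨x, ⟨hxZ, hxS⟩, hvx⟩
    exact ⟨⟨x, ⟨hxZ, Or.inr hxS⟩, hvx⟩, ⟨x, hxS, hvx⟩⟩
  have h4 : nbhd G (Z ∩ nbhd G S) ∩ S ⊆ nbhd G (Z ∩ closedNbhd G S) ∩ S := by
    rintro v ⟨⟨x, ⟨hxZ, hxS⟩, hvx⟩, hv⟩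
    exact ⟨⟨x, ⟨hxZ, Or.inl hxS⟩, hvx⟩, hv⟩
  have h3' := Set.ncard_le_ncard h3 (Set.toFinite _)
  have h4' := Set.ncard_le_ncard h4 (Set.toFinite _)
  unfold diffd at h ⊢
  omega

/-- An independent set inside the closed neighborhood of a critical independent set `S` is no
larger than `S`. -/
theorem IsCritical.ncard_le_of_subset_closedNbhd {V : Type*} [Finite V] {G : SimpleGraph V}
    {S T : Set V} (hS : IsCritical G S) (hI : IndepSet G S) (hT : IndepSet G T)
    (hTS : T ⊆ closedNbhd G S) : T.ncard ≤ S.ncard := by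
  have hall := hS.ncard_le_ncard_nbhd_inter (Y := T ∩ nbhd G S) Set.inter_subset_right
  have h1 := hI.ncard_inter_closedNbhd T
  rw [Set.inter_eq_left.2 hTS] at h1
  have hsub : nbhd G (T ∩ nbhd G S) ∩ S ⊆ S \ T := by
    rintro v ⟨⟨x, ⟨hxT, -⟩, hvx⟩, hv⟩
    exact ⟨hv, fun hvT => hT hvT hxT hvx⟩
  have h2 := Set.ncard_le_ncard hsub (Set.toFinite _)
  have h3 := Set.ncard_inter_add_ncard_sdiff_eq_ncard S T (Set.toFinite _)
  rw [Set.inter_comm] at h3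
  omega

/-- The closed neighborhoods of maximum critical independent sets are contained in each other. -/
theorem closedNbhd_subset_of_mem_maxCritIndepFam {V : Type*} [Finite V] {G : SimpleGraph V}
    {S A : Set V} (hS : S ∈ maxCritIndepFam G) (hA : A ∈ maxCritIndepFam G) :
    closedNbhd G A ⊆ closedNbhd G S := by
  obtain ⟨hSI, hSC, hSmax⟩ := hS
  obtain ⟨hAI, hAC, -⟩ := hA
  have hd : diffd G A = diffd G S := hAC.trans hSC.symm
  have hB := hSC.ncard_inter_closedNbhd_sub_le hSI A
  have hBsub : nbhd G (A ∩ closedNbhd G S) ∩ closedNbhd G S ⊆ nbhd G A ∩ closedNbhd G S := by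
    rintro v ⟨⟨x, ⟨hxA, -⟩, hvx⟩, hv⟩
    exact ⟨⟨x, hxA, hvx⟩, hv⟩
  have hBcard := Set.ncard_le_ncard hBsub (Set.toFinite _)
  have hA1 := Set.ncard_inter_add_ncard_sdiff_eq_ncard A (closedNbhd G S) (Set.toFinite _)
  have hA2 := Set.ncard_inter_add_ncard_sdiff_eq_ncard (nbhd G A) (closedNbhd G S) (Set.toFinite _)
  have hout : (nbhd G A \ closedNbhd G S).ncard ≤ (A \ closedNbhd G S).ncard := by
    unfold diffd at hd hB
    omega
  have hcard : (S ∪ A \ closedNbhd G S).ncard = S.ncard + (A \ closedNbhd G S).ncard := by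
    refine Set.ncard_union_eq ?_ (Set.toFinite _) (Set.toFinite _)
    exact Set.disjoint_left.2 fun v hv hv' => hv'.2 (Or.inr hv)
  have hindep : IndepSet G (S ∪ A \ closedNbhd G S) := by
    rintro u (hu | hu) v (hv | hv) huv
    · exact hSI hu hv huv
    · exact hv.2 (Or.inl ⟨u, hu, huv.symm⟩)
    · exact hu.2 (Or.inl ⟨v, hv, huv⟩)
    · exact hAI hu.1 hv.1 huv
  have hnb : nbhd G (S ∪ A \ closedNbhd G S) ⊆ nbhd G S ∪ nbhd G A \ closedNbhd G S := by
    rintro v ⟨x, hx | hx, hvx⟩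
    · exact Or.inl ⟨x, hx, hvx⟩
    · by_cases hv : v ∈ nbhd G S
      · exact Or.inl hv
      · refine Or.inr ⟨⟨x, hx.1, hvx⟩, ?_⟩
        rintro (h | h)
        · exact hv h
        · exact hx.2 (Or.inl ⟨v, h, hvx.symm⟩)
  have hnbcard := (Set.ncard_le_ncard hnb (Set.toFinite _)).trans (Set.ncard_union_le _ _)
  have hcrit : IsCritical G (S ∪ A \ closedNbhd G S) := by
    rw [isCritical_iff_forall_diffd_le] at hSC ⊢
    intro Z
    refine (hSC Z).trans ?_
    unfold diffd
    omega
  have hle := hSmax _ hindep hcrit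
  have hA0 : A \ closedNbhd G S = ∅ := (Set.ncard_eq_zero (Set.toFinite _)).1 (by omega)
  have hN0 : nbhd G A \ closedNbhd G S = ∅ := (Set.ncard_eq_zero (Set.toFinite _)).1 (by omega)
  exact Set.union_subset (Set.sdiff_eq_empty.1 hN0) (Set.sdiff_eq_empty.1 hA0)

theorem image_val_nbhd_induce {V : Type*} (G : SimpleGraph V) (X : Set V) (Z : Set X) :
    Subtype.val '' nbhd (G.induce X) Z = nbhd G (Subtype.val '' Z) ∩ X := by
  ext v
  constructor
  · rintro ⟨v, ⟨x, hx, hvx⟩, rfl⟩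
    exact ⟨⟨x, ⟨x, hx, rfl⟩, hvx⟩, v.2⟩
  · rintro ⟨⟨_, ⟨x, hx, rfl⟩, hvx⟩, hv⟩
    exact ⟨⟨v, hv⟩, ⟨x, hx, hvx⟩, rfl⟩

theorem diffd_induce {V : Type*} (G : SimpleGraph V) (X : Set V) (Z : Set X) :
    diffd (G.induce X) Z =
      ((Subtype.val '' Z).ncard : ℤ) - ((nbhd G (Subtype.val '' Z) ∩ X).ncard : ℤ) := by
  rw [← image_val_nbhd_induce, Set.ncard_image_of_injective _ Subtype.val_injective,
    Set.ncard_image_of_injective _ Subtype.val_injective, diffd]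

/-- Every maximum critical independent set of `G` is one of `G[N[S]]`. -/
theorem preimage_mem_maxCritIndepFam_induce {V : Type*} [Finite V] {G : SimpleGraph V}
    {S A : Set V} (hS : S ∈ maxCritIndepFam G) (hA : A ∈ maxCritIndepFam G) :
    (Subtype.val ⁻¹' A : Set (closedNbhd G S)) ∈ maxCritIndepFam (G.induce (closedNbhd G S)) := by
  have hsub := closedNbhd_subset_of_mem_maxCritIndepFam hS hA
  have hAX : A ⊆ closedNbhd G S := Set.subset_union_right.trans hsub
  have hNX : nbhd G A ⊆ closedNbhd G S := Set.subset_union_left.trans hsub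
  have himg : Subtype.val '' (Subtype.val ⁻¹' A : Set (closedNbhd G S)) = A := by
    rw [Subtype.image_preimage_coe, Set.inter_eq_right.2 hAX]
  obtain ⟨hSI, hSC, -⟩ := hS
  obtain ⟨hAI, hAC, hAmax⟩ := hA
  refine ⟨fun u hu v hv huv => hAI hu hv huv, ?_, ?_⟩
  · rw [isCritical_iff_forall_diffd_le]
    intro Z
    have hZ : Subtype.val '' Z ⊆ closedNbhd G S := Subtype.coe_image_subset _ _
    have h := hSC.ncard_inter_closedNbhd_sub_le hSI (Subtype.val '' Z)
    rw [Set.inter_eq_left.2 hZ, ← diffd_induce] at h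
    refine h.trans_eq ?_
    rw [diffd_induce, himg, Set.inter_eq_left.2 hNX]
    exact hSC.trans hAC.symm
  · intro T hT _
    rw [← Set.ncard_image_of_injective T Subtype.val_injective,
      ← Set.ncard_image_of_injective (Subtype.val ⁻¹' A) Subtype.val_injective, himg]
    refine (hSC.ncard_le_of_subset_closedNbhd hSI ?_ (Subtype.coe_image_subset _ _)).trans
      (hAmax S hSI hSC)
    rintro _ ⟨u, hu, rfl⟩ _ ⟨v, hv, rfl⟩ huv
    exact hT hu hv huv

/-- If `S` is a maximum critical independent set of `G` and `X = N[S]`, then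
`diadem(G) ⊆ diadem(G[X])` and `nucleus(G[X]) ⊆ nucleus(G)`
(the sets for the induced subgraph `G[X]` viewed as subsets of `V(G)`). -/
theorem stmt1 {V : Type*} [Fintype V] (G : SimpleGraph V)
    (S : Set V) (hS : S ∈ maxCritIndepFam G) (X : Set V) (hX : X = closedNbhd G S) :
    diadem G ⊆ Subtype.val '' diadem (G.induce X) ∧
    Subtype.val '' nucleus (G.induce X) ⊆ nucleus G := by
  subst hX
  constructor
  · rintro v ⟨A, hA, hv⟩
    have hvX : v ∈ closedNbhd G S := closedNbhd_subset_of_mem_maxCritIndepFam hS hA (Or.inr hv)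
    exact ⟨⟨v, hvX⟩, ⟨_, preimage_mem_maxCritIndepFam_induce hS hA, hv⟩, rfl⟩
  · rintro _ ⟨x, hx, rfl⟩ A hA
    exact hx _ (preimage_mem_maxCritIndepFam_induce hS hA)
end

section
/- For every finite simple graph G, |ker(G)| + |diadem(G)| ≤ 2α(G). -/
section CriticalSets

variable {V : Type*} [Fintype V] {G : SimpleGraph V}

lemma diffd_le_critDiff (X : Set V) : diffd G X ≤ critDiff G :=
  le_csSup (Set.finite_range (diffd G)).bddAbove ⟨X, rfl⟩

lemma exists_isCritical (G : SimpleGraph V) : ∃ X : Set V, IsCritical G X :=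
  Int.csSup_mem (s := {d : ℤ | ∃ X : Set V, diffd G X = d}) ⟨_, ∅, rfl⟩
    (Set.finite_range (diffd G)).bddAbove

lemma isCritical_of_le {X : Set V} (h : critDiff G ≤ diffd G X) : IsCritical G X :=
  le_antisymm (diffd_le_critDiff X) h

lemma IndepSet.ncard_le_indNum {S : Set V} (hS : IndepSet G S) : S.ncard ≤ indNum G :=
  le_csSup ⟨Nat.card V, by rintro _ ⟨T, -, rfl⟩; exact Set.ncard_le_card T⟩ ⟨S, hS, rfl⟩

lemma diffd_add_diffd_le (X Y : Set V) :
    diffd G X + diffd G Y ≤ diffd G (X ∪ Y) + diffd G (X ∩ Y) := by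
  have hu : nbhd G (X ∪ Y) = nbhd G X ∪ nbhd G Y := by
    ext v
    simp only [nbhd, Set.mem_ofPred_eq, Set.mem_union]
    grind
  have hi : (nbhd G (X ∩ Y)).ncard ≤ (nbhd G X ∩ nbhd G Y).ncard := by
    refine Set.ncard_le_ncard ?_ (Set.toFinite _)
    rintro v ⟨x, hx, hv⟩
    exact ⟨⟨x, hx.1, hv⟩, ⟨x, hx.2, hv⟩⟩
  have h1 := Set.ncard_union_add_ncard_inter X Y
  have h2 := Set.ncard_union_add_ncard_inter (nbhd G X) (nbhd G Y)
  unfold diffd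
  rw [hu]
  omega

lemma IsCritical.inter {X Y : Set V} (hX : IsCritical G X) (hY : IsCritical G Y) :
    IsCritical G (X ∩ Y) := by
  have h := diffd_add_diffd_le (G := G) X Y
  have hu := diffd_le_critDiff (G := G) (X ∪ Y)
  unfold IsCritical at hX hY
  exact isCritical_of_le (by omega)

lemma exists_indepSet_isCritical (G : SimpleGraph V) :
    ∃ X : Set V, IndepSet G X ∧ IsCritical G X := by
  obtain ⟨X, hX⟩ := exists_isCritical G
  refine ⟨X \ nbhd G X, fun u hu v hv h => hu.2 ⟨v, hv.1, h⟩, isCritical_of_le ?_⟩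
  have hsub : (nbhd G (X \ nbhd G X)).ncard ≤ (nbhd G X \ X).ncard := by
    refine Set.ncard_le_ncard ?_ (Set.toFinite _)
    rintro v ⟨x, hx, hv⟩
    exact ⟨⟨x, hx.1, hv⟩, fun hvX => hx.2 ⟨v, hvX, hv.symm⟩⟩
  have h1 := Set.ncard_inter_add_ncard_sdiff_eq_ncard X (nbhd G X)
  have h2 := Set.ncard_inter_add_ncard_sdiff_eq_ncard (nbhd G X) X
  rw [Set.inter_comm] at h2
  unfold IsCritical at hX
  rw [← hX]
  unfold diffd
  omega

lemma isCritical_kerSet (G : SimpleGraph V) : IsCritical G (kerSet G) := by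
  obtain ⟨K, hK, hmin⟩ := Set.exists_min_image {A : Set V | IndepSet G A ∧ IsCritical G A}
    Set.ncard (Set.toFinite _) (exists_indepSet_isCritical G)
  have hsub : K ⊆ kerSet G := fun v hv A hA => by
    have hKA : K ∩ A = K := Set.eq_of_subset_of_ncard_le Set.inter_subset_left
      (hmin _ ⟨fun _ hu _ hw => hK.1 hu.1 hw.1, hK.2.inter hA.2⟩) (Set.toFinite _)
    exact (hKA.ge hv).2
  have heq : kerSet G = K := (Set.sInter_subset_of_mem hK).antisymm hsub
  exact heq ▸ hK.2

lemma maxCritIndepFam_nonempty (G : SimpleGraph V) : (maxCritIndepFam G).Nonempty := by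
  obtain ⟨S, hS, hmax⟩ := Set.exists_max_image {A : Set V | IndepSet G A ∧ IsCritical G A}
    Set.ncard (Set.toFinite _) (exists_indepSet_isCritical G)
  exact ⟨S, hS.1, hS.2, fun T hT hTc => hmax T ⟨hT, hTc⟩⟩

/-- If `A` is critical, then for every `S` at least as many vertices of `A`
have neighbors in `S` as vertices of `S` have neighbors in `A`. -/
lemma IsCritical.ncard_inter_nbhd_le {A : Set V} (hA : IsCritical G A) (S : Set V) :
    (S ∩ nbhd G A).ncard ≤ (A ∩ nbhd G S).ncard := by
  have hsub : (nbhd G (A \ nbhd G S)).ncard ≤ (nbhd G A \ S).ncard := by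
    refine Set.ncard_le_ncard ?_ (Set.toFinite _)
    rintro v ⟨x, hx, hv⟩
    exact ⟨⟨x, hx.1, hv⟩, fun hvS => hx.2 ⟨v, hvS, hv.symm⟩⟩
  have h1 := Set.ncard_inter_add_ncard_sdiff_eq_ncard A (nbhd G S)
  have h2 := Set.ncard_inter_add_ncard_sdiff_eq_ncard (nbhd G A) S
  rw [Set.inter_comm] at h2
  have h3 := diffd_le_critDiff (G := G) (A \ nbhd G S)
  unfold IsCritical at hA
  rw [← hA] at h3
  unfold diffd at h3
  omega

/-- Adding to a critical independent set `A` the vertices of a critical independent set `S` that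
have no neighbor in `A` gives a critical set. -/
lemma IsCritical.union_diff_nbhd {A S : Set V} (hA : IsCritical G A) (hS : IsCritical G S)
    (hAi : IndepSet G A) : IsCritical G (A ∪ S \ nbhd G A) := by
  have hdisj : Disjoint A (nbhd G A) :=
    Set.disjoint_left.2 fun a ha ⟨b, hb, hab⟩ => hAi ha hb hab
  have hsub : (nbhd G (A ∪ S \ nbhd G A)).ncard + (A ∩ nbhd G S).ncard ≤
      (nbhd G A ∪ nbhd G S).ncard := by
    rw [← Set.ncard_union_eq]
    · refine Set.ncard_le_ncard ?_ (Set.toFinite _)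
      rintro v (⟨x, hx | hx, hv⟩ | hv)
      · exact Or.inl ⟨x, hx, hv⟩
      · exact Or.inr ⟨x, hx.1, hv⟩
      · exact Or.inr hv.2
    · refine Set.disjoint_left.2 ?_
      rintro v ⟨x, hx | hx, hv⟩ hvA
      · exact hAi hvA.1 hx hv
      · exact hx.2 ⟨v, hvA.1, hv.symm⟩
  have hcard : (A ∪ S).ncard ≤ (A ∪ S \ nbhd G A).ncard + (S ∩ nbhd G A).ncard := by
    refine le_trans (Set.ncard_le_ncard ?_ (Set.toFinite _)) (Set.ncard_union_le _ _)
    intro v hv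
    by_cases h : v ∈ nbhd G A <;> simp_all
  have h1 := hA.ncard_inter_nbhd_le S
  have h2 := Set.ncard_union_add_ncard_inter A S
  have h3 := Set.ncard_union_add_ncard_inter (nbhd G A) (nbhd G S)
  have h4 := diffd_le_critDiff (G := G) (A ∩ S)
  have hi : (nbhd G (A ∩ S)).ncard ≤ (nbhd G A ∩ nbhd G S).ncard := by
    refine Set.ncard_le_ncard ?_ (Set.toFinite _)
    rintro v ⟨x, hx, hv⟩
    exact ⟨⟨x, hx.1, hv⟩, ⟨x, hx.2, hv⟩⟩
  apply isCritical_of_le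
  unfold IsCritical at hA hS
  unfold diffd at *
  omega

lemma subset_closedNbhd_of_mem_maxCritIndepFam {A S : Set V} (hA : A ∈ maxCritIndepFam G)
    (hSi : IndepSet G S) (hS : IsCritical G S) : S ⊆ closedNbhd G A := by
  obtain ⟨hAi, hAc, hmax⟩ := hA
  have hind : IndepSet G (A ∪ S \ nbhd G A) := by
    rintro u (hu | hu) v (hv | hv) h
    · exact hAi hu hv h
    · exact hv.2 ⟨u, hu, h.symm⟩
    · exact hu.2 ⟨v, hv, h⟩
    · exact hSi hu.1 hv.1 h
  have heq : A = A ∪ S \ nbhd G A := Set.eq_of_subset_of_ncard_le Set.subset_union_left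
    (hmax _ hind (hAc.union_diff_nbhd hS hAi)) (Set.toFinite _)
  intro v hv
  by_cases h : v ∈ nbhd G A
  · exact Or.inl h
  · exact Or.inr (heq ▸ Or.inr ⟨hv, h⟩)

end CriticalSets

/-- For every finite simple graph `G`,
`|ker(G)| + |diadem(G)| ≤ 2α(G)`. -/
theorem stmt4 {V : Type*} [Fintype V] (G : SimpleGraph V) :
    (kerSet G).ncard + (diadem G).ncard ≤ 2 * indNum G := by
  obtain ⟨A, hA⟩ := maxCritIndepFam_nonempty G
  have hsub : diadem G ⊆ closedNbhd G A := Set.sUnion_subset fun S hS =>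
    subset_closedNbhd_of_mem_maxCritIndepFam hA hS.1 hS.2.1
  have hker : nbhd G (kerSet G) ⊆ nbhd G A :=
    fun v ⟨x, hx, hv⟩ => ⟨x, hx A ⟨hA.1, hA.2.1⟩, hv⟩
  have hdisj : Disjoint (diadem G) (nbhd G (kerSet G)) := by
    refine Set.disjoint_left.2 ?_
    rintro v ⟨S, hS, hvS⟩ ⟨x, hx, hv⟩
    exact hS.1 hvS (hx S ⟨hS.1, hS.2.1⟩) hv
  have hcard : (diadem G).ncard + (nbhd G (kerSet G)).ncard ≤ (nbhd G A).ncard + A.ncard := by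
    rw [← Set.ncard_union_eq hdisj]
    exact le_trans (Set.ncard_le_ncard
      (Set.union_subset hsub (hker.trans Set.subset_union_left)) (Set.toFinite _))
      (Set.ncard_union_le _ _)
  have hα := hA.1.ncard_le_indNum
  have hd : diffd G (kerSet G) = diffd G A := (isCritical_kerSet G).trans hA.2.1.symm
  unfold diffd at hd
  omega
end
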